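/- Let Ω ⊂ ℝⁿ be a bounded open set with C² boundary and U ⊂ ℝⁿ open with cl(Ω) ⊂ U and σ₀ := dist(cl(Ω), ℝⁿ∖U) > 0. Suppose f : [0,T]×U×ℝⁿ → ℝ satisfies (f0)–(f2) and g : U → ℝ satisfies (g1). Set σ = min{σ₀, ρ₀} and let ξ ∈ C^∞(ℝ) satisfy ξ = 0 on (−∞,1/3], 0 < ξ < 1 on (1/3,2/3), and ξ = 1 on [2/3,∞). Then the function f̃(t,x,v) = ξ(b_Ω(x)/σ)·|v|²/2 + (1 − ξ(b_Ω(x)/σ))·f(t,x,v), defined for all (t,x,v) ∈ [0,T]×ℝⁿ×ℝⁿ, extends f and satisfies (f0)–(f2) with U = ℝⁿ, and g̃(x) = (1 − ξ(b_Ω(x)/σ))·g(x) extends g and satisfies (g1) with U = ℝⁿ. -/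

import Mathlib

open MeasureTheory Set Metric Filter
open scoped Topology NNReal RealInnerProductSpace

noncomputable section

abbrev EucSp (n : ℕ) := EuclideanSpace ℝ (Fin n)

/-- Distance from the closure of `Ω`. -/
def dOm {n : ℕ} (Ω : Set (EucSp n)) (x : EucSp n) : ℝ := Metric.infDist x (closure Ω)

/-- Oriented boundary distance `b_Ω = d_Ω - d_{Ω^c}`. -/
def bOm {n : ℕ} (Ω : Set (EucSp n)) (x : EucSp n) : ℝ := dOm Ω x - Metric.infDist x Ωᶜ

/-- Gradient of the oriented boundary distance. -/
def DbOm {n : ℕ} (Ω : Set (EucSp n)) (x : EucSp n) : EucSp n := gradient (bOm Ω) x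

/-- The tube `Σ_ρ = ∪_{y ∈ ∂Ω} B(y, ρ)`. -/
def tubeNbhd {n : ℕ} (Ω : Set (EucSp n)) (ρ : ℝ) : Set (EucSp n) :=
  ⋃ y ∈ frontier Ω, Metric.ball y ρ

/-- `Ω` has "C² boundary data at scale ρ₀": `b_Ω` is C² with bounded derivatives on the tube. -/
def C2Bdry {n : ℕ} (Ω : Set (EucSp n)) (ρ₀ : ℝ) : Prop :=
  0 < ρ₀ ∧ ContDiffOn ℝ 2 (bOm Ω) (tubeNbhd Ω ρ₀) ∧
    ∃ C : ℝ, ∀ x ∈ tubeNbhd Ω ρ₀,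
      ‖DbOm Ω x‖ ≤ C ∧ ‖fderiv ℝ (fun y => DbOm Ω y) x‖ ≤ C

/-- Absolute continuity on `[0,T]` via an integrable a.e. derivative and FTC. -/
def AbsCont {n : ℕ} (T : ℝ) (γ : ℝ → EucSp n) : Prop :=
  ∃ γ' : ℝ → EucSp n, IntegrableOn γ' (Icc 0 T) ∧
    ∀ t ∈ Icc 0 T, γ t = γ 0 + ∫ s in (0:ℝ)..t, γ' s

/-- State constraint: the curve stays in `cl Ω` on `[0,T]`. -/
def InCl {n : ℕ} (Ω : Set (EucSp n)) (T : ℝ) (γ : ℝ → EucSp n) : Prop :=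
  ∀ t ∈ Icc 0 T, γ t ∈ closure Ω

/-- The functional `J[γ] = ∫₀ᵀ f(t,γ,γ̇) dt + g(γ(T))`. -/
def costJ {n : ℕ} (T : ℝ) (f : ℝ → EucSp n → EucSp n → ℝ) (g : EucSp n → ℝ)
    (γ : ℝ → EucSp n) : ℝ :=
  (∫ t in (0:ℝ)..T, f t (γ t) (deriv γ t)) + g (γ T)

/-- Minimizer of the constrained problem over `Γ[x]`. -/
def IsMinCon {n : ℕ} (Ω : Set (EucSp n)) (T : ℝ) (f : ℝ → EucSp n → EucSp n → ℝ)
    (g : EucSp n → ℝ) (x : EucSp n) (γ : ℝ → EucSp n) : Prop :=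
  AbsCont T γ ∧ InCl Ω T γ ∧ γ 0 = x ∧
    ∀ σ : ℝ → EucSp n, AbsCont T σ → InCl Ω T σ → σ 0 = x →
      costJ T f g γ ≤ costJ T f g σ

/-- Penalized functional. -/
def costPen {n : ℕ} (Ω : Set (EucSp n)) (T ε δ : ℝ) (f : ℝ → EucSp n → EucSp n → ℝ)
    (g : EucSp n → ℝ) (γ : ℝ → EucSp n) : ℝ :=
  (∫ t in (0:ℝ)..T, (f t (γ t) (deriv γ t) + (1/ε) * dOm Ω (γ t)))
    + (1/δ) * dOm Ω (γ T) + g (γ T)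

/-- Minimizer of the penalized problem. -/
def IsPenMin {n : ℕ} (Ω : Set (EucSp n)) (T ε δ : ℝ) (f : ℝ → EucSp n → EucSp n → ℝ)
    (g : EucSp n → ℝ) (x : EucSp n) (γ : ℝ → EucSp n) : Prop :=
  AbsCont T γ ∧ γ 0 = x ∧
    ∀ σ : ℝ → EucSp n, AbsCont T σ → σ 0 = x →
      costPen Ω T ε δ f g γ ≤ costPen Ω T ε δ f g σ

/-- Assumptions (f0)-(f2). -/
structure FAssumptions {n : ℕ} (T : ℝ) (U : Set (EucSp n))
    (f : ℝ → EucSp n → EucSp n → ℝ)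
    (Dxf Dvf : ℝ → EucSp n → EucSp n → EucSp n)
    (Dvvf Dvxf : ℝ → EucSp n → EucSp n → (EucSp n →L[ℝ] EucSp n))
    (M μ κ : ℝ) : Prop where
  Mnonneg : 0 ≤ M
  μge : 1 ≤ μ
  κnonneg : 0 ≤ κ
  fCont : ContinuousOn (fun p : ℝ × EucSp n × EucSp n => f p.1 p.2.1 p.2.2)
    ((Icc 0 T) ×ˢ U ×ˢ (univ : Set (EucSp n)))
  hDxf : ∀ t ∈ Icc 0 T, ∀ x ∈ U, ∀ v : EucSp n,
    HasGradientAt (fun y => f t y v) (Dxf t x v) x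
  hDvf : ∀ t ∈ Icc 0 T, ∀ x ∈ U, ∀ v : EucSp n,
    HasGradientAt (fun w => f t x w) (Dvf t x v) v
  DxfCont : ContinuousOn (fun p : ℝ × EucSp n × EucSp n => Dxf p.1 p.2.1 p.2.2)
    ((Icc 0 T) ×ˢ U ×ˢ (univ : Set (EucSp n)))
  DvfCont : ContinuousOn (fun p : ℝ × EucSp n × EucSp n => Dvf p.1 p.2.1 p.2.2)
    ((Icc 0 T) ×ˢ U ×ˢ (univ : Set (EucSp n)))
  bound0 : ∀ t ∈ Icc 0 T, ∀ x ∈ U, |f t x 0| + ‖Dxf t x 0‖ + ‖Dvf t x 0‖ ≤ M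
  hDvvf : ∀ t ∈ Icc 0 T, ∀ x ∈ U, ∀ v : EucSp n,
    HasFDerivAt (fun w => Dvf t x w) (Dvvf t x v) v
  hDvxf : ∀ t ∈ Icc 0 T, ∀ x ∈ U, ∀ v : EucSp n,
    HasFDerivAt (fun y => Dvf t y v) (Dvxf t x v) x
  DvvfCont : ContinuousOn (fun p : ℝ × EucSp n × EucSp n => Dvvf p.1 p.2.1 p.2.2)
    ((Icc 0 T) ×ˢ U ×ˢ (univ : Set (EucSp n)))
  DvxfCont : ContinuousOn (fun p : ℝ × EucSp n × EucSp n => Dvxf p.1 p.2.1 p.2.2)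
    ((Icc 0 T) ×ˢ U ×ˢ (univ : Set (EucSp n)))
  vvLower : ∀ t ∈ Icc 0 T, ∀ x ∈ U, ∀ v w : EucSp n,
    (1/μ) * ‖w‖^2 ≤ ⟪Dvvf t x v w, w⟫
  vvUpper : ∀ t ∈ Icc 0 T, ∀ x ∈ U, ∀ v w : EucSp n,
    ⟪Dvvf t x v w, w⟫ ≤ μ * ‖w‖^2
  vxBound : ∀ t ∈ Icc 0 T, ∀ x ∈ U, ∀ v : EucSp n, ‖Dvxf t x v‖ ≤ μ * (1 + ‖v‖)
  tLip : ∀ t ∈ Icc 0 T, ∀ s ∈ Icc 0 T, ∀ x ∈ U, ∀ v : EucSp n,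
    |f t x v - f s x v| ≤ κ * (1 + ‖v‖^2) * |t - s|
  DvfTLip : ∀ t ∈ Icc 0 T, ∀ s ∈ Icc 0 T, ∀ x ∈ U, ∀ v : EucSp n,
    ‖Dvf t x v - Dvf s x v‖ ≤ κ * (1 + ‖v‖) * |t - s|

/-- Assumption (g1): `g ∈ C¹_b(U)` with gradient `Dg` and bound `Cg`. -/
structure GAssumptions {n : ℕ} (U : Set (EucSp n)) (g : EucSp n → ℝ)
    (Dg : EucSp n → EucSp n) (Cg : ℝ) : Prop where
  grad : ∀ x ∈ U, HasGradientAt g (Dg x) x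
  contDg : ContinuousOn Dg U
  bdd : ∀ x ∈ U, |g x| ≤ Cg ∧ ‖Dg x‖ ≤ Cg

/-- The Hamiltonian `H(t,x,p) = sup_v {-⟨p,v⟩ - f(t,x,v)}`. -/
def ham {n : ℕ} (f : ℝ → EucSp n → EucSp n → ℝ) (t : ℝ) (x p : EucSp n) : ℝ :=
  ⨆ v : EucSp n, (-⟪p, v⟫ - f t x v)

def DpH {n : ℕ} (f : ℝ → EucSp n → EucSp n → ℝ) (t : ℝ) (x p : EucSp n) : EucSp n :=
  gradient (fun q => ham f t x q) p

def DxH {n : ℕ} (f : ℝ → EucSp n → EucSp n → ℝ) (t : ℝ) (x p : EucSp n) : EucSp n :=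
  gradient (fun y => ham f t y p) x

def DppH {n : ℕ} (f : ℝ → EucSp n → EucSp n → ℝ) (t : ℝ) (x p : EucSp n) :
    EucSp n →L[ℝ] EucSp n := fderiv ℝ (fun q => DpH f t x q) p

def DpxH {n : ℕ} (f : ℝ → EucSp n → EucSp n → ℝ) (t : ℝ) (x p : EucSp n) :
    EucSp n →L[ℝ] EucSp n := fderiv ℝ (fun y => DpH f t y p) x

def DptH {n : ℕ} (f : ℝ → EucSp n → EucSp n → ℝ) (t : ℝ) (x p : EucSp n) : EucSp n :=
  deriv (fun s => DpH f s x p) t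

/-- The explicit feedback function `Λ`. -/
def LamFun {n : ℕ} (Ω : Set (EucSp n)) (f : ℝ → EucSp n → EucSp n → ℝ)
    (t : ℝ) (x p : EucSp n) : ℝ :=
  (-⟪(fderiv ℝ (fun y => DbOm Ω y) x) (DpH f t x p), DpH f t x p⟫
    - ⟪DbOm Ω x, DptH f t x p⟫
    - ⟪DbOm Ω x, DpxH f t x p (DpH f t x p)⟫
    + ⟪DbOm Ω x, DppH f t x p (DxH f t x p)⟫)
  / ⟪DbOm Ω x, DppH f t x p (DbOm Ω x)⟫

/-- `γ` is `C^{1,1}` on `[0,T]` with derivative `γd`. -/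
def IsC11On {n : ℕ} (T : ℝ) (γ γd : ℝ → EucSp n) : Prop :=
  (∀ t ∈ Icc 0 T, HasDerivWithinAt γ (γd t) (Icc 0 T) t) ∧
    ∃ K : ℝ≥0, LipschitzOnWith K γd (Icc 0 T)


section Gluing

variable {n : ℕ} {A U : Set (EucSp n)} {φ : EucSp n → ℝ} {ψ : EucSp n → EucSp n} {T : ℝ}

/-- A function vanishing off the closed set `A` is continuous everywhere as soon as it is
continuous on an open neighbourhood of `A`. -/
theorem continuousOn_univ_of_eq_zero_off {F : Type*} [NormedAddCommGroup F]
    (hA : IsClosed A) (hU : IsOpen U) (hAU : A ⊆ U) {G : ℝ × EucSp n × EucSp n → F}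
    (hG : ContinuousOn G (Icc 0 T ×ˢ U ×ˢ univ)) (hG0 : ∀ p, p.2.1 ∉ A → G p = 0) :
    ContinuousOn G (Icc 0 T ×ˢ univ ×ˢ univ) := by
  rintro p ⟨hpt, -⟩
  by_cases hp : p.2.1 ∈ A
  · have hnhds : {q : ℝ × EucSp n × EucSp n | q.2.1 ∈ U} ∈ 𝓝 p :=
      (hU.preimage (continuous_fst.comp continuous_snd)).mem_nhds (hAU hp)
    refine (hG p ⟨hpt, hAU hp, mem_univ _⟩).mono_of_mem_nhdsWithin ?_
    filter_upwards [self_mem_nhdsWithin, mem_nhdsWithin_of_mem_nhds hnhds] with q hq hqU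
    exact ⟨hq.1, hqU, mem_univ _⟩
  · have hnhds : {q : ℝ × EucSp n × EucSp n | q.2.1 ∉ A} ∈ 𝓝 p :=
      (hA.isOpen_compl.preimage (continuous_fst.comp continuous_snd)).mem_nhds hp
    refine ContinuousAt.continuousWithinAt ?_
    refine (continuousAt_const (y := (0 : F))).congr ?_
    filter_upwards [hnhds] with q hq
    exact (hG0 q hq).symm

theorem gradient_eq_zero_off (hA : IsClosed A) (hφ : ∀ x, HasGradientAt φ (ψ x) x)
    (hφ0 : ∀ x ∉ A, φ x = 0) {x : EucSp n} (hx : x ∉ A) : ψ x = 0 := by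
  refine (hφ x).unique ((hasGradientAt_const x (0 : ℝ)).congr_of_eventuallyEq ?_)
  filter_upwards [hA.isOpen_compl.mem_nhds hx] with y hy using hφ0 y hy

/-- Product rule for a cut-off function times a function that is only controlled on `U`. -/
theorem hasFDerivAt_cutoff_smul {F : Type*} [NormedAddCommGroup F] [NormedSpace ℝ F]
    (hA : IsClosed A) (hAU : A ⊆ U) (hφ : ∀ x, HasGradientAt φ (ψ x) x)
    (hφ0 : ∀ x ∉ A, φ x = 0) {h : EucSp n → F} {h' : EucSp n → EucSp n →L[ℝ] F}
    (hh : ∀ x ∈ U, HasFDerivAt h (h' x) x) (x : EucSp n) :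
    HasFDerivAt (fun y => φ y • h y)
      (φ x • h' x + (InnerProductSpace.toDual ℝ (EucSp n) (ψ x)).smulRight (h x)) x := by
  by_cases hx : x ∈ A
  · exact (hφ x).hasFDerivAt.smul (hh x (hAU hx))
  · rw [hφ0 x hx, gradient_eq_zero_off hA hφ hφ0 hx]
    have h0 : HasFDerivAt (fun _ : EucSp n => (0 : F)) (0 : EucSp n →L[ℝ] F) x :=
      hasFDerivAt_const _ _
    convert h0.congr_of_eventuallyEq ?_ using 1
    · ext; simp
    · filter_upwards [hA.isOpen_compl.mem_nhds hx] with y hy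
      simp [hφ0 y hy]

theorem hasGradientAt_cutoff_mul
    (hA : IsClosed A) (hAU : A ⊆ U) (hφ : ∀ x, HasGradientAt φ (ψ x) x)
    (hφ0 : ∀ x ∉ A, φ x = 0) {h : EucSp n → ℝ} {h' : EucSp n → EucSp n}
    (hh : ∀ x ∈ U, HasGradientAt h (h' x) x) (x : EucSp n) :
    HasGradientAt (fun y => φ y * h y) (φ x • h' x + h x • ψ x) x := by
  rw [hasGradientAt_iff_hasFDerivAt]
  refine (hasFDerivAt_cutoff_smul hA hAU hφ hφ0
    (fun y hy => (hh y hy).hasFDerivAt) x).congr_fderiv ?_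
  ext1 z
  simp [mul_comm]

theorem norm_le_of_inner_self_bounds {B : EucSp n →L[ℝ] EucSp n} {μ : ℝ} (hμ : 0 ≤ μ)
    (hsymm : ∀ v w, ⟪B v, w⟫ = ⟪B w, v⟫) (hlow : ∀ w, 0 ≤ ⟪B w, w⟫)
    (hup : ∀ w, ⟪B w, w⟫ ≤ μ * ‖w‖ ^ 2) : ‖B‖ ≤ μ := by
  refine B.opNorm_le_bound hμ fun w => ?_
  have key : ∀ s : ℝ, 0 ≤ ⟪B w, w⟫ * (s * s) + (-2 * ‖B w‖ ^ 2) * s + μ * ‖B w‖ ^ 2 := by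
    intro s
    have h1 := hlow (s • w - B w)
    have h2 := hup (B w)
    have h3 : ⟪B (B w), w⟫ = ‖B w‖ ^ 2 := by
      rw [hsymm, real_inner_self_eq_norm_sq]
    simp only [map_sub, map_smul, inner_sub_left, inner_sub_right, inner_smul_left,
      inner_smul_right, h3, real_inner_self_eq_norm_sq, RCLike.conj_to_real] at h1
    nlinarith
  have hd := discrim_le_zero key
  rw [discrim] at hd
  have h4 := hup w
  by_contra! hlt
  have hpos : 0 < ‖B w‖ := (by positivity : 0 ≤ μ * ‖w‖).trans_lt hlt
  have h5 : ‖B w‖ ^ 2 ≤ ⟪B w, w⟫ * μ := by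
    have : ‖B w‖ ^ 2 * ‖B w‖ ^ 2 ≤ ‖B w‖ ^ 2 * (⟪B w, w⟫ * μ) := by nlinarith
    exact le_of_mul_le_mul_left this (by positivity)
  have h6 : ‖B w‖ ^ 2 ≤ (μ * ‖w‖) ^ 2 := by nlinarith
  exact hlt.not_ge ((sq_le_sq₀ hpos.le (by positivity)).1 h6)

variable {f : ℝ → EucSp n → EucSp n → ℝ} {Dxf Dvf : ℝ → EucSp n → EucSp n → EucSp n}
  {Dvvf Dvxf : ℝ → EucSp n → EucSp n → (EucSp n →L[ℝ] EucSp n)} {M μ κ : ℝ}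

theorem FAssumptions.norm_Dvvf_le (hf : FAssumptions T U f Dxf Dvf Dvvf Dvxf M μ κ)
    {t : ℝ} (ht : t ∈ Icc 0 T) {x : EucSp n} (hx : x ∈ U) (v : EucSp n) :
    ‖Dvvf t x v‖ ≤ μ := by
  have hμ := hf.μge
  refine norm_le_of_inner_self_bounds (by linarith) (fun a b => ?_) (fun w => ?_)
    (hf.vvUpper t ht x hx v)
  · have h2 : HasFDerivAt (fun w => InnerProductSpace.toDual ℝ (EucSp n) (Dvf t x w))
        (((innerSL ℝ : EucSp n →L[ℝ] EucSp n →L[ℝ] ℝ)).comp (Dvvf t x v)) v :=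
      (innerSL ℝ : EucSp n →L[ℝ] EucSp n →L[ℝ] ℝ).hasFDerivAt.comp v (hf.hDvvf t ht x hx v)
    exact second_derivative_symmetric (fun w => (hf.hDvf t ht x hx w).hasFDerivAt) h2 a b
  · exact le_trans (by positivity) (hf.vvLower t ht x hx v w)

theorem FAssumptions.norm_Dvf_le (hf : FAssumptions T U f Dxf Dvf Dvvf Dvxf M μ κ)
    {t : ℝ} (ht : t ∈ Icc 0 T) {x : EucSp n} (hx : x ∈ U) (v : EucSp n) :
    ‖Dvf t x v‖ ≤ M + μ * ‖v‖ := by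
  have h1 := convex_univ.norm_image_sub_le_of_norm_hasFDerivWithin_le
    (fun w _ => (hf.hDvvf t ht x hx w).hasFDerivWithinAt)
    (fun w _ => hf.norm_Dvvf_le ht hx w) (mem_univ (0 : EucSp n)) (mem_univ v)
  have h2 := hf.bound0 t ht x hx
  have h3 := norm_le_norm_add_norm_sub' (Dvf t x v) (Dvf t x 0)
  rw [sub_zero] at h1
  linarith [abs_nonneg (f t x 0), norm_nonneg (Dxf t x 0)]

theorem GAssumptions.cutoff {g : EucSp n → ℝ} {Dg : EucSp n → EucSp n} {Cg L : ℝ}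
    (hg : GAssumptions U g Dg Cg) (hU : IsOpen U) (hA : IsClosed A) (hAU : A ⊆ U)
    (hφ : ∀ x, HasGradientAt φ (ψ x) x) (hψ : Continuous ψ) (hφ0 : ∀ x ∉ A, φ x = 0)
    (hφI : ∀ x, φ x ∈ Icc (0 : ℝ) 1) (hL : ∀ x, ‖ψ x‖ ≤ L) :
    GAssumptions univ (fun x => φ x * g x) (fun x => φ x • Dg x + g x • ψ x)
      (|Cg| + |Cg| * L) := by
  have hφc : Continuous φ := continuous_iff_continuousAt.2 fun x => (hφ x).continuousAt
  have hL0 : 0 ≤ L := (norm_nonneg _).trans (hL 0)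
  refine ⟨fun x _ => hasGradientAt_cutoff_mul hA hAU hφ hφ0 hg.grad x, ?_, fun x _ => ?_⟩
  · rw [continuousOn_univ, continuous_iff_continuousAt]
    intro x
    by_cases hx : x ∈ A
    · have hxU := hU.mem_nhds (hAU hx)
      exact (hφc.continuousAt.smul (hg.contDg.continuousAt hxU)).add
        ((hg.grad x (hAU hx)).continuousAt.smul hψ.continuousAt)
    · refine (continuousAt_const (y := (0 : EucSp n))).congr ?_
      filter_upwards [hA.isOpen_compl.mem_nhds hx] with y hy
      simp [hφ0 y hy, gradient_eq_zero_off hA hφ hφ0 hy]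
  · by_cases hx : x ∈ A
    · obtain ⟨h1, h2⟩ := hg.bdd x (hAU hx)
      have h1' : |g x| ≤ |Cg| := h1.trans (le_abs_self _)
      have h2' : ‖Dg x‖ ≤ |Cg| := h2.trans (le_abs_self _)
      obtain ⟨h3, h4⟩ := hφI x
      constructor
      · rw [abs_mul, abs_of_nonneg h3]
        have : φ x * |g x| ≤ 1 * |Cg| := by gcongr
        have : 0 ≤ |Cg| * L := by positivity
        linarith
      · refine (norm_add_le _ _).trans ?_
        rw [norm_smul, norm_smul, Real.norm_eq_abs, Real.norm_eq_abs, abs_of_nonneg h3]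
        have : φ x * ‖Dg x‖ ≤ 1 * |Cg| := by gcongr
        have : |g x| * ‖ψ x‖ ≤ |Cg| * L := by gcongr; exact hL x
        linarith
    · simp only [hφ0 x hx, gradient_eq_zero_off hA hφ hφ0 hx]
      have : 0 ≤ |Cg| + |Cg| * L := by positivity
      simp [this]

theorem hasGradientAt_half_norm_sq (v : EucSp n) :
    HasGradientAt (fun w : EucSp n => ‖w‖ ^ 2 / 2) v v := by
  rw [hasGradientAt_iff_hasFDerivAt]
  refine (((hasStrictFDerivAt_norm_sq v).hasFDerivAt.const_mul (1 / 2 : ℝ)).congr_fderiv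
    ?_).congr_of_eventuallyEq (Eventually.of_forall fun w => ?_)
  · ext1 z
    simp
  · ring

theorem FAssumptions.interpolate {L : ℝ} (hf : FAssumptions T U f Dxf Dvf Dvvf Dvxf M μ κ)
    (hU : IsOpen U) (hA : IsClosed A) (hAU : A ⊆ U)
    (hφ : ∀ x, HasGradientAt φ (ψ x) x) (hψ : Continuous ψ) (hφ0 : ∀ x ∉ A, φ x = 0)
    (hφI : ∀ x, φ x ∈ Icc (0 : ℝ) 1) (hL : ∀ x, ‖ψ x‖ ≤ L) :
    FAssumptions T univ (fun t x v => (1 - φ x) * (‖v‖ ^ 2 / 2) + φ x * f t x v)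
      (fun t x v => (φ x • Dxf t x v + f t x v • ψ x) - (‖v‖ ^ 2 / 2) • ψ x)
      (fun t x v => (1 - φ x) • v + φ x • Dvf t x v)
      (fun t x v => (1 - φ x) • ContinuousLinearMap.id ℝ (EucSp n) + φ x • Dvvf t x v)
      (fun t x v => (φ x • Dvxf t x v + InnerProductSpace.rankOne ℝ (Dvf t x v) (ψ x)) -
        InnerProductSpace.rankOne ℝ v (ψ x))
      (M + M * L) (μ + L * (1 + M + μ)) κ := by
  have hφc : Continuous φ := continuous_iff_continuousAt.2 fun x => (hφ x).continuousAt
  have hψ0 : ∀ x ∉ A, ψ x = 0 := fun x hx => gradient_eq_zero_off hA hφ hφ0 hx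
  have hL0 : 0 ≤ L := (norm_nonneg _).trans (hL 0)
  have hM := hf.Mnonneg
  have hμ := hf.μge
  have hκ := hf.κnonneg
  have hμ' : μ ≤ μ + L * (1 + M + μ) := le_add_of_nonneg_right (by positivity)
  have hφp : Continuous fun p : ℝ × EucSp n × EucSp n => φ p.2.1 := by fun_prop
  have hψp : Continuous fun p : ℝ × EucSp n × EucSp n => ψ p.2.1 := by fun_prop
  have hvp : Continuous fun p : ℝ × EucSp n × EucSp n => p.2.2 := by fun_prop
  have hgrad1 : ∀ x, HasGradientAt (fun y => 1 - φ y) (-ψ x) x := fun x => by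
    rw [hasGradientAt_iff_hasFDerivAt, map_neg]
    exact (hφ x).hasFDerivAt.const_sub 1
  have hvv : ∀ t ∈ Icc 0 T, ∀ x, ∀ v w : EucSp n,
      (1 / μ) * ‖w‖ ^ 2 ≤ (1 - φ x) * ‖w‖ ^ 2 + φ x * ⟪Dvvf t x v w, w⟫ ∧
      (1 - φ x) * ‖w‖ ^ 2 + φ x * ⟪Dvvf t x v w, w⟫ ≤ μ * ‖w‖ ^ 2 := by
    intro t ht x v w
    obtain ⟨h0, h1⟩ := hφI x
    have hμinv : 1 / μ ≤ 1 := by rw [div_le_one (by linarith)]; exact hμ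
    have hw : 0 ≤ ‖w‖ ^ 2 := by positivity
    by_cases hx : x ∈ A
    · have hl := hf.vvLower t ht x (hAU hx) v w
      have hu := hf.vvUpper t ht x (hAU hx) v w
      have e1 : 1 / μ * ‖w‖ ^ 2 ≤ ‖w‖ ^ 2 := mul_le_of_le_one_left hw hμinv
      have e2 : ‖w‖ ^ 2 ≤ μ * ‖w‖ ^ 2 := le_mul_of_one_le_left hw hμ
      constructor <;> nlinarith
    · rw [hφ0 x hx]
      constructor <;> nlinarith
  refine
    { Mnonneg := by positivity
      μge := hμ.trans hμ'
      κnonneg := hκ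
      fCont := ?_
      hDxf := fun t ht x _ v => ?_
      hDvf := fun t ht x _ v => ?_
      DxfCont := ?_
      DvfCont := ?_
      bound0 := fun t ht x _ => ?_
      hDvvf := fun t ht x _ v => ?_
      hDvxf := fun t ht x _ v => ?_
      DvvfCont := ?_
      DvxfCont := ?_
      vvLower := fun t ht x _ v w => ?_
      vvUpper := fun t ht x _ v w => ?_
      vxBound := fun t ht x _ v => ?_
      tLip := fun t ht s hs x _ v => ?_
      DvfTLip := fun t ht s hs x _ v => ?_ }
  · refine ContinuousOn.add (Continuous.continuousOn (by fun_prop)) ?_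
    refine continuousOn_univ_of_eq_zero_off hA hU hAU (hφp.continuousOn.mul hf.fCont) ?_
    intro p hp
    simp [hφ0 _ hp]
  · rw [hasGradientAt_iff_hasFDerivAt]
    refine (((hgrad1 x).hasFDerivAt.mul_const (‖v‖ ^ 2 / 2)).add
      (hasGradientAt_cutoff_mul hA hAU hφ hφ0
        (hf.hDxf t ht · · v) x).hasFDerivAt).congr_fderiv ?_
    ext1 z
    simp
    ring
  · by_cases hx : x ∈ A
    · rw [hasGradientAt_iff_hasFDerivAt]
      refine (((hasGradientAt_half_norm_sq v).hasFDerivAt.const_mul (1 - φ x)).add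
        ((hf.hDvf t ht x (hAU hx) v).hasFDerivAt.const_mul (φ x))).congr_fderiv ?_
      ext1 z
      simp
    · simpa [hφ0 x hx] using hasGradientAt_half_norm_sq v
  · refine ContinuousOn.sub ?_ (Continuous.continuousOn (by fun_prop))
    refine continuousOn_univ_of_eq_zero_off hA hU hAU
      ((hφp.continuousOn.smul hf.DxfCont).add (hf.fCont.smul hψp.continuousOn)) ?_
    intro p hp
    simp [hφ0 _ hp, hψ0 _ hp]
  · refine ContinuousOn.add (Continuous.continuousOn (by fun_prop)) ?_
    refine continuousOn_univ_of_eq_zero_off hA hU hAU (hφp.continuousOn.smul hf.DvfCont) ?_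
    intro p hp
    simp [hφ0 _ hp]
  · by_cases hx : x ∈ A
    · have hb := hf.bound0 t ht x (hAU hx)
      obtain ⟨h0, h1⟩ := hφI x
      have e1 : |f t x 0| * ‖ψ x‖ ≤ M * L := by
        gcongr
        · linarith [norm_nonneg (Dxf t x 0), norm_nonneg (Dvf t x 0)]
        · exact hL x
      have e2 := norm_add_le (φ x • Dxf t x 0) (f t x 0 • ψ x)
      simp only [norm_smul, Real.norm_eq_abs, abs_of_nonneg h0] at e2
      have e3 : φ x * (|f t x 0| + ‖Dxf t x 0‖ + ‖Dvf t x 0‖) ≤ M :=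
        (mul_le_of_le_one_left (by positivity) h1).trans hb
      simp only [norm_zero, smul_zero, zero_add, norm_smul, Real.norm_eq_abs, abs_mul,
        abs_of_nonneg h0, ne_eq, OfNat.ofNat_ne_zero, not_false_eq_true, zero_pow, zero_div,
        mul_zero, zero_smul, sub_zero]
      linarith
    · have : 0 ≤ M + M * L := by positivity
      simpa [hφ0 x hx, hψ0 x hx]
  · by_cases hx : x ∈ A
    · have h1 : HasFDerivAt (fun w : EucSp n => (1 - φ x) • w)
          ((1 - φ x) • ContinuousLinearMap.id ℝ (EucSp n)) v :=
        ((1 - φ x) • ContinuousLinearMap.id ℝ (EucSp n)).hasFDerivAt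
      exact h1.add ((hf.hDvvf t ht x (hAU hx) v).const_smul (φ x))
    · have h0 : (0 : ℝ) • Dvvf t x v = 0 :=
        ContinuousLinearMap.ext fun z => zero_smul ℝ _
      simpa [hφ0 x hx, h0] using! hasFDerivAt_id (𝕜 := ℝ) v
  · refine (((hgrad1 x).hasFDerivAt.smul_const v).add
      (hasFDerivAt_cutoff_smul hA hAU hφ hφ0 (hf.hDvxf t ht · · v) x)).congr_fderiv ?_
    ext1 z
    simp [InnerProductSpace.rankOne_apply]
    abel
  · refine ContinuousOn.add (Continuous.continuousOn (by fun_prop)) ?_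
    refine continuousOn_univ_of_eq_zero_off hA hU hAU (hφp.continuousOn.smul hf.DvvfCont) ?_
    intro p hp
    simp only [hφ0 _ hp]
    exact ContinuousLinearMap.ext fun z => zero_smul ℝ _
  · refine ContinuousOn.sub ?_
      (((InnerProductSpace.rankOne ℝ).continuous.comp hvp).clm_apply hψp).continuousOn
    refine continuousOn_univ_of_eq_zero_off hA hU hAU
      ((hφp.continuousOn.smul hf.DvxfCont).add
        (((InnerProductSpace.rankOne ℝ).continuous.comp_continuousOn hf.DvfCont).clm_apply
          hψp.continuousOn)) ?_
    intro p hp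
    simp only [hφ0 _ hp, hψ0 _ hp, map_zero, add_zero]
    exact ContinuousLinearMap.ext fun z => zero_smul ℝ _
  · have h := (hvv t ht x v w).1
    have hle : 1 / (μ + L * (1 + M + μ)) * ‖w‖ ^ 2 ≤ 1 / μ * ‖w‖ ^ 2 := by gcongr
    simpa [inner_add_left, inner_smul_left] using hle.trans h
  · have h := (hvv t ht x v w).2
    have hle : μ * ‖w‖ ^ 2 ≤ (μ + L * (1 + M + μ)) * ‖w‖ ^ 2 := by gcongr
    simpa [inner_add_left, inner_smul_left] using h.trans hle
  · by_cases hx : x ∈ A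
    · obtain ⟨h0, h1⟩ := hφI x
      have hv := norm_nonneg v
      have e1 := norm_sub_le (φ x • Dvxf t x v + InnerProductSpace.rankOne ℝ (Dvf t x v) (ψ x))
        (InnerProductSpace.rankOne ℝ v (ψ x))
      have e2 := norm_add_le (φ x • Dvxf t x v) (InnerProductSpace.rankOne ℝ (Dvf t x v) (ψ x))
      simp only [InnerProductSpace.norm_rankOne, norm_smul, Real.norm_eq_abs,
        abs_of_nonneg h0] at e1 e2
      have e3 : φ x * ‖Dvxf t x v‖ ≤ μ * (1 + ‖v‖) :=
        (mul_le_of_le_one_left (norm_nonneg _) h1).trans (hf.vxBound t ht x (hAU hx) v)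
      have e4 : ‖Dvf t x v‖ * ‖ψ x‖ ≤ (M + μ * ‖v‖) * L := by
        gcongr
        · exact hf.norm_Dvf_le ht (hAU hx) v
        · exact hL x
      have e5 : ‖v‖ * ‖ψ x‖ ≤ ‖v‖ * L := by gcongr; exact hL x
      have e6 : 0 ≤ L * (1 + μ + M * ‖v‖) := by positivity
      nlinarith
    · have : 0 ≤ (μ + L * (1 + M + μ)) * (1 + ‖v‖) := by positivity
      have h0 : (0 : ℝ) • Dvxf t x v = 0 :=
        ContinuousLinearMap.ext fun z => zero_smul ℝ _
      simp only [hφ0 x hx, hψ0 x hx, h0, map_zero, add_zero, sub_zero, norm_zero, this]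
  · obtain ⟨h0, h1⟩ := hφI x
    rw [add_sub_add_left_eq_sub, ← mul_sub, abs_mul, abs_of_nonneg h0]
    by_cases hx : x ∈ A
    · exact (mul_le_of_le_one_left (abs_nonneg _) h1).trans (hf.tLip t ht s hs x (hAU hx) v)
    · rw [hφ0 x hx, zero_mul]; positivity
  · obtain ⟨h0, h1⟩ := hφI x
    rw [add_sub_add_left_eq_sub, ← smul_sub, norm_smul, Real.norm_eq_abs, abs_of_nonneg h0]
    by_cases hx : x ∈ A
    · exact (mul_le_of_le_one_left (norm_nonneg _) h1).trans (hf.DvfTLip t ht s hs x (hAU hx) v)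
    · rw [hφ0 x hx, zero_mul]; positivity

end Gluing

section OrientedDistance

variable {n : ℕ} {Ω : Set (EucSp n)}

theorem continuous_bOm : Continuous (bOm Ω) :=
  (continuous_infDist_pt _).sub (continuous_infDist_pt _)

theorem bOm_nonpos {x : EucSp n} (hx : x ∈ closure Ω) : bOm Ω x ≤ 0 := by
  have h1 : dOm Ω x = 0 := infDist_zero_of_mem hx
  have h2 : 0 ≤ infDist x Ωᶜ := infDist_nonneg
  rw [bOm, h1]
  linarith

theorem bOm_eq_dOm {x : EucSp n} (hx : x ∉ closure Ω) : bOm Ω x = dOm Ω x := by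
  have h2 : infDist x Ωᶜ = 0 := infDist_zero_of_mem fun h => hx (subset_closure h)
  rw [bOm, h2, sub_zero]

theorem mem_tubeNbhd_of_bOm_pos (hΩ : Ω.Nonempty) {x : EucSp n} {ρ : ℝ} (h0 : 0 < bOm Ω x)
    (hρ : bOm Ω x < ρ) : x ∈ tubeNbhd Ω ρ := by
  have hx : x ∈ (closure Ω)ᶜ := fun h => h0.not_ge (bOm_nonpos h)
  obtain ⟨y, hy, hxy⟩ := exists_mem_frontier_infDist_compl_eq_dist hx
    (by simpa [compl_univ_iff] using hΩ.ne_empty)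
  rw [compl_compl] at hxy
  rw [frontier_compl] at hy
  refine mem_iUnion₂.2 ⟨y, frontier_closure_subset hy, ?_⟩
  rwa [mem_ball, ← hxy, ← dOm, ← bOm_eq_dOm hx]

theorem isOpen_tubeNbhd (ρ : ℝ) : IsOpen (tubeNbhd Ω ρ) :=
  isOpen_biUnion fun _ _ => isOpen_ball

theorem contDiff_comp_bOm (hΩ : Ω.Nonempty) {ρ₀ σ : ℝ} (hC2 : C2Bdry Ω ρ₀) (hσ : 0 < σ)
    (hσρ : σ ≤ ρ₀) {ξ : ℝ → ℝ} (hξ : ContDiff ℝ 1 ξ) (hξ0 : ∀ s ≤ 1 / 3, ξ s = 0)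
    (hξ1 : ∀ s, 2 / 3 ≤ s → ξ s = 1) : ContDiff ℝ 1 fun x => ξ (bOm Ω x / σ) := by
  have hcont : Continuous fun x => bOm Ω x / σ := continuous_bOm.div_const σ
  rw [contDiff_iff_contDiffAt]
  intro x
  rcases lt_or_ge (bOm Ω x / σ) (1 / 3) with h | h
  · refine (contDiffAt_const (c := (0 : ℝ))).congr_of_eventuallyEq ?_
    filter_upwards [hcont.continuousAt.eventually_lt_const h] with y hy using hξ0 _ hy.le
  rcases lt_or_ge (2 / 3) (bOm Ω x / σ) with h' | h'
  · refine (contDiffAt_const (c := (1 : ℝ))).congr_of_eventuallyEq ?_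
    filter_upwards [hcont.continuousAt.eventually_const_lt h'] with y hy using hξ1 _ hy.le
  · rw [le_div_iff₀ hσ] at h
    rw [div_le_iff₀ hσ] at h'
    have hx : x ∈ tubeNbhd Ω ρ₀ := mem_tubeNbhd_of_bOm_pos hΩ (by linarith) (by linarith)
    have hb : ContDiffAt ℝ 1 (bOm Ω) x :=
      (hC2.2.1.contDiffAt ((isOpen_tubeNbhd ρ₀).mem_nhds hx)).of_le (by norm_num)
    exact hξ.contDiffAt.comp x (hb.div_const σ)

theorem le_dOm_of_notMem (hΩ : Ω.Nonempty) {U : Set (EucSp n)} {x : EucSp n} (hx : x ∉ U) :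
    sInf {d : ℝ | ∃ x ∈ closure Ω, ∃ y ∈ Uᶜ, d = dist x y} ≤ dOm Ω x := by
  refine (le_infDist hΩ.closure).2 fun {y} hy => csInf_le ⟨0, ?_⟩ ⟨y, hy, x, hx, dist_comm x y⟩
  rintro _ ⟨a, -, b, -, rfl⟩
  exact dist_nonneg

theorem isClosed_dOm_le (r : ℝ) : IsClosed {x | dOm Ω x ≤ r} :=
  isClosed_le (continuous_infDist_pt _) continuous_const

theorem isCompact_dOm_le (hΩ : Ω.Nonempty) (hΩb : Bornology.IsBounded Ω) (r : ℝ) :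
    IsCompact {x | dOm Ω x ≤ r} := by
  refine isCompact_of_isClosed_isBounded (isClosed_dOm_le r)
    ((hΩb.cthickening (δ := r)).subset fun x hx => ?_)
  rw [← cthickening_closure]
  obtain ⟨y, hy, hxy⟩ := exists_mem_closure_infDist_eq_dist hΩ.closure x
  rw [closure_closure] at hy
  exact mem_cthickening_of_dist_le x y r _ hy (hxy ▸ hx)

end OrientedDistance

/-- Lemma 3.8: extension of the data `f` and `g` to the whole
space preserving assumptions (f0)-(f2) and (g1). -/
theorem extension_of_data {n : ℕ} (Ω U : Set (EucSp n)) (T ρ₀ σ₀ : ℝ)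
    (hT : 0 < T) (hΩo : IsOpen Ω) (hΩb : Bornology.IsBounded Ω) (hΩne : Ω.Nonempty)
    (hC2 : C2Bdry Ω ρ₀) (hU : IsOpen U) (hUΩ : closure Ω ⊆ U)
    (hσ₀ : σ₀ = sInf {d : ℝ | ∃ x ∈ closure Ω, ∃ y ∈ Uᶜ, d = dist x y})
    (hσ₀pos : 0 < σ₀)
    (f : ℝ → EucSp n → EucSp n → ℝ)
    (Dxf Dvf : ℝ → EucSp n → EucSp n → EucSp n)
    (Dvvf Dvxf : ℝ → EucSp n → EucSp n → (EucSp n →L[ℝ] EucSp n))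
    (M μ κ : ℝ) (hf : FAssumptions T U f Dxf Dvf Dvvf Dvxf M μ κ)
    (g : EucSp n → ℝ) (Dg : EucSp n → EucSp n) (Cg : ℝ)
    (hg : GAssumptions U g Dg Cg)
    -- the cut-off function ξ
    (ξ : ℝ → ℝ) (hξsmooth : ContDiff ℝ (⊤ : ℕ∞) ξ)
    (hξ0 : ∀ s : ℝ, s ≤ 1/3 → ξ s = 0)
    (hξmid : ∀ s ∈ Ioo (1/3 : ℝ) (2/3), 0 < ξ s ∧ ξ s < 1)
    (hξ1 : ∀ s : ℝ, 2/3 ≤ s → ξ s = 1)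
    (σ : ℝ) (hσ : σ = min σ₀ ρ₀)
    (ft : ℝ → EucSp n → EucSp n → ℝ)
    (hft : ft = fun t x v =>
      ξ (bOm Ω x / σ) * (‖v‖^2 / 2) + (1 - ξ (bOm Ω x / σ)) * f t x v)
    (gt : EucSp n → ℝ)
    (hgt : gt = fun x => (1 - ξ (bOm Ω x / σ)) * g x) :
    -- `ft` and `gt` extend `f` and `g`
    (∀ t ∈ Icc 0 T, ∀ x ∈ closure Ω, ∀ v : EucSp n, ft t x v = f t x v) ∧
    (∀ x ∈ closure Ω, gt x = g x) ∧
    -- `ft` satisfies (f0)-(f2) with `U = ℝⁿ` (with constants `M'`, the same `μ` up to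
    -- `max`, and the same `κ`)
    (∃ (Dxft Dvft : ℝ → EucSp n → EucSp n → EucSp n)
        (Dvvft Dvxft : ℝ → EucSp n → EucSp n → (EucSp n →L[ℝ] EucSp n))
        (M' μ' : ℝ),
      FAssumptions T (univ : Set (EucSp n)) ft Dxft Dvft Dvvft Dvxft M' μ' κ) ∧
    -- `gt` satisfies (g1) with `U = ℝⁿ`
    (∃ (Dgt : EucSp n → EucSp n) (Cg' : ℝ),
      GAssumptions (univ : Set (EucSp n)) gt Dgt Cg') := by
  have hσ0 : 0 < σ := hσ ▸ lt_min hσ₀pos hC2.1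
  have hσσ₀ : σ ≤ σ₀ := hσ ▸ min_le_left _ _
  have hσρ₀ : σ ≤ ρ₀ := hσ ▸ min_le_right _ _
  have hξ1' : ContDiff ℝ 1 ξ := hξsmooth.of_le (by exact_mod_cast le_top)
  have hξI : ∀ s, ξ s ∈ Icc (0 : ℝ) 1 := by
    intro s
    rcases le_or_gt s (1 / 3) with h | h
    · simp [hξ0 s h]
    rcases le_or_gt (2 / 3) s with h' | h'
    · simp [hξ1 s h']
    · exact ⟨(hξmid s ⟨h, h'⟩).1.le, (hξmid s ⟨h, h'⟩).2.le⟩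
  have hξΩ : ∀ x ∈ closure Ω, ξ (bOm Ω x / σ) = 0 := fun x hx =>
    hξ0 _ ((div_nonpos_of_nonpos_of_nonneg (bOm_nonpos hx) hσ0.le).trans (by norm_num))
  set φ : EucSp n → ℝ := fun x => 1 - ξ (bOm Ω x / σ) with hφdef
  have hφC : ContDiff ℝ 1 φ :=
    contDiff_const.sub (contDiff_comp_bOm hΩne hC2 hσ0 hσρ₀ hξ1' hξ0 hξ1)
  have hφI : ∀ x, φ x ∈ Icc (0 : ℝ) 1 := fun x => by
    have h := hξI (bOm Ω x / σ)
    exact ⟨by simpa [hφdef] using h.2, by simpa [hφdef] using h.1⟩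
  set A : Set (EucSp n) := {x | dOm Ω x ≤ 2 / 3 * σ} with hAdef
  have hAU : A ⊆ U := by
    intro x hx
    by_contra hxU
    have h := le_dOm_of_notMem hΩne hxU
    rw [← hσ₀] at h
    have hx' : dOm Ω x ≤ 2 / 3 * σ := hx
    linarith
  have hφ0 : ∀ x ∉ A, φ x = 0 := by
    intro x hx
    have hx' : 2 / 3 * σ < dOm Ω x := not_le.1 hx
    have hxΩ : x ∉ closure Ω := fun h => by
      have h0 : dOm Ω x = 0 := infDist_zero_of_mem h
      linarith
    have h1 : ξ (bOm Ω x / σ) = 1 := hξ1 _ (by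
      rw [bOm_eq_dOm hxΩ, le_div_iff₀ hσ0]
      exact hx'.le)
    simp [hφdef, h1]
  have hgrad : ∀ x, HasGradientAt φ (gradient φ x) x := fun x =>
    (hφC.differentiable one_ne_zero x).hasGradientAt
  have hgradc : Continuous (gradient φ) :=
    (InnerProductSpace.toDual ℝ (EucSp n)).symm.continuous.comp
      (hφC.continuous_fderiv one_ne_zero)
  obtain ⟨L, hL⟩ := hgradc.bounded_above_of_compact_support
    (HasCompactSupport.intro (isCompact_dOm_le hΩne hΩb (2 / 3 * σ)) fun x hx =>
      gradient_eq_zero_off (isClosed_dOm_le _) hgrad hφ0 hx)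
  have hft' : ft = fun t x v => (1 - φ x) * (‖v‖ ^ 2 / 2) + φ x * f t x v := by
    rw [hft]
    simp [hφdef]
  refine ⟨fun t _ x hx v => ?_, fun x hx => ?_, ?_, ?_⟩
  · simp [hft, hξΩ x hx]
  · simp [hgt, hξΩ x hx]
  · rw [hft']
    exact ⟨_, _, _, _, _, _,
      hf.interpolate hU (isClosed_dOm_le _) hAU hgrad hgradc hφ0 hφI hL⟩
  · rw [hgt]
    exact ⟨_, _, hg.cutoff hU (isClosed_dOm_le _) hAU hgrad hgradc hφ0 hφI hL⟩

end
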